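/- Let T be the standard baker's map, T(x,y) = (x/2, 2y) if y < 1/2 and T(x,y) = ((x+1)/2, 2y−1) if y ≥ 1/2, preserving Lebesgue measure Leb on [0,1]². For Lebesgue-almost every z ∈ [0,1]² (in particular z is not periodic) the following holds: for every τ > 0 and every sequence (u_n) of reals satisfying n · Leb(B(z, e^{−u_n})) → τ as n → ∞, one has Leb( { x ∈ [0,1]² : max_{0 ≤ j ≤ n−1} ( −log d(T^j x, z) ) ≤ u_n } ) → e^{−τ} as n → ∞, where d is the Euclidean distance and B(z,r) the open Euclidean ball. -/

import Mathlib

open MeasureTheory Filter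
open scoped Classical Topology

/-- The standard baker's map: `T(x,y) = (x/2, 2y)` if `y < 1/2` and
`T(x,y) = ((x+1)/2, 2y-1)` if `y ≥ 1/2`. -/
noncomputable def bakerMap (p : ℝ × ℝ) : ℝ × ℝ :=
  if p.2 < 1 / 2 then (p.1 / 2, 2 * p.2) else ((p.1 + 1) / 2, 2 * p.2 - 1)

/-- The unit square `[0,1]²`. -/
def unitSq : Set (ℝ × ℝ) := Set.Icc (0:ℝ) 1 ×ˢ Set.Icc (0:ℝ) 1

/-- The Euclidean distance on `ℝ²`. -/
noncomputable def euclDist (p q : ℝ × ℝ) : ℝ :=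
  Real.sqrt ((p.1 - q.1) ^ 2 + (p.2 - q.2) ^ 2)

/-- The open Euclidean ball of center `z` and radius `r` in `ℝ²`. -/
def euclBall (z : ℝ × ℝ) (r : ℝ) : Set (ℝ × ℝ) :=
  {w | Real.sqrt ((w.1 - z.1) ^ 2 + (w.2 - z.2) ^ 2) < r}

/-- hitting-free set -/
def GG {α : Type*} (T : α → α) (A : Set α) (t : ℕ) : Set α := {p | ∀ j < t, T^[j] p ∉ A}

section abs
variable {α : Type*} [MeasurableSpace α] {μ : Measure α} [IsProbabilityMeasure μ] {T : α → α}

lemma GG_meas (hT : MeasurePreserving T μ μ) {A : Set α} (hA : MeasurableSet A) (t : ℕ) :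
    MeasurableSet (GG T A t) := by
  have : GG T A t = ⋂ j, ⋂ (_ : j < t), (T^[j]) ⁻¹' Aᶜ := by
    ext p; simp [GG]
  rw [this]
  exact MeasurableSet.iInter fun j => MeasurableSet.iInter fun _ => (hT.iterate j).measurable hA.compl

lemma mp_real (hT : MeasurePreserving T μ μ) {A : Set α} (hA : MeasurableSet A) (j : ℕ) :
    μ.real ((T^[j]) ⁻¹' A) = μ.real A := by
  simp only [Measure.real, (hT.iterate j).measure_preimage hA.nullMeasurableSet]

lemma rec_step (hT : MeasurePreserving T μ μ) {A : Set α} (hA : MeasurableSet A) (l : ℕ) (hl : 1 ≤ l)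
    (hind : ∀ t, μ.real (A ∩ (T^[l]) ⁻¹' (GG T A t)) = μ.real A * μ.real (GG T A t)) (t : ℕ) :
    |μ.real (GG T A (t+1)) - (1 - μ.real A) * μ.real (GG T A t)| ≤
      ∑ j ∈ Finset.Ico 1 l, μ.real (A ∩ (T^[j]) ⁻¹' A) + l * μ.real A ^ 2 := by
  set a := μ.real A with ha
  set ρ := ∑ j ∈ Finset.Ico 1 l, μ.real (A ∩ (T^[j]) ⁻¹' A) with hρ
  set x := μ.real (A ∩ T ⁻¹' (GG T A t)) with hx
  set s := t + 1 - l with hs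
  have h1 : μ.real (GG T A (t+1)) = μ.real (GG T A t) - x := by
    have e : GG T A (t+1) = (T ⁻¹' (GG T A t)) \ A := by
      ext p
      simp only [GG, Set.mem_ofPred_eq, Set.mem_sdiff, Set.mem_preimage]
      constructor
      · intro h
        exact ⟨fun j hj => by simpa using h (j+1) (by omega), by simpa using h 0 (by omega)⟩
      · rintro ⟨h, h0⟩ j hj
        rcases j with _ | j
        · simpa using h0
        · simpa using h j (by omega)
    have e2 := measureReal_inter_add_sdiff (μ := μ) (s := T ⁻¹' (GG T A t)) hA
    have e3 := mp_real hT (GG_meas hT hA t) 1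
    simp only [Function.iterate_one] at e3
    rw [e3, Set.inter_comm] at e2
    rw [e]; linarith
  have h2 : x ≤ a * μ.real (GG T A s) := by
    rw [← hind]
    apply measureReal_mono _ (by finiteness)
    rintro p ⟨hp, hp2⟩
    refine ⟨hp, fun j hj => ?_⟩
    have := hp2 (j + l - 1) (by omega)
    rw [← Function.iterate_succ_apply] at this
    rw [← Function.iterate_add_apply]
    convert this using 3; omega
  have h3 : a * μ.real (GG T A s) ≤ x + ρ := by
    rw [← hind]
    have : A ∩ (T^[l]) ⁻¹' (GG T A s) ⊆ (A ∩ T ⁻¹' (GG T A t)) ∪ ⋃ j ∈ Finset.Ico 1 l, (A ∩ (T^[j]) ⁻¹' A) := by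
      rintro p ⟨hp, hp2⟩
      by_cases hc : p ∈ T ⁻¹' (GG T A t)
      · exact Or.inl ⟨hp, hc⟩
      right
      simp only [GG, Set.mem_preimage, Set.mem_ofPred_eq, not_forall, not_not] at hc
      obtain ⟨i, hi, hi2⟩ := hc
      rw [← Function.iterate_succ_apply] at hi2
      simp only [Set.mem_iUnion]
      refine ⟨i+1, ?_, hp, hi2⟩
      rw [Finset.mem_Ico]
      refine ⟨by omega, ?_⟩
      by_contra hcon
      apply hp2 (i + 1 - l) (by omega)
      rw [← Function.iterate_add_apply]
      convert hi2 using 3; omega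
    refine (measureReal_mono this (by finiteness)).trans ((measureReal_union_le _ _).trans ?_)
    gcongr
    exact measureReal_biUnion_finset_le _ _
  have h4 : μ.real (GG T A t) ≤ μ.real (GG T A s) := by
    apply measureReal_mono _ (by finiteness)
    intro p hp j hj
    exact hp j (by omega)
  have h5 : μ.real (GG T A s) ≤ μ.real (GG T A t) + l * a := by
    have : GG T A s ⊆ GG T A t ∪ ⋃ j ∈ Finset.Ico s t, (T^[j]) ⁻¹' A := by
      intro p hp
      by_cases hc : p ∈ GG T A t
      · exact Or.inl hc
      right
      simp only [GG, Set.mem_ofPred_eq, not_forall, not_not] at hc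
      obtain ⟨i, hi, hi2⟩ := hc
      simp only [Set.mem_iUnion]
      refine ⟨i, ?_, hi2⟩
      rw [Finset.mem_Ico]
      refine ⟨?_, hi⟩
      by_contra hcon
      exact hp i (by omega) hi2
    refine (measureReal_mono this (by finiteness)).trans ((measureReal_union_le _ _).trans ?_)
    gcongr
    refine (measureReal_biUnion_finset_le _ _).trans ?_
    simp only [mp_real hT hA, Finset.sum_const, Nat.card_Ico, nsmul_eq_mul]
    gcongr
    omega
  have ha0 : 0 ≤ a := measureReal_nonneg
  have hρ0 : 0 ≤ ρ := Finset.sum_nonneg fun _ _ => measureReal_nonneg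
  rw [h1, abs_le]
  have h6 := mul_le_mul_of_nonneg_left h5 ha0
  have h7 := mul_le_mul_of_nonneg_left h4 ha0
  have h8 : 0 ≤ l * a ^ 2 := by positivity
  constructor <;> nlinarith

lemma rec_all (hT : MeasurePreserving T μ μ) {A : Set α} (hA : MeasurableSet A) (l : ℕ) (hl : 1 ≤ l)
    (hind : ∀ t, μ.real (A ∩ (T^[l]) ⁻¹' (GG T A t)) = μ.real A * μ.real (GG T A t)) (n : ℕ) :
    |μ.real (GG T A n) - (1 - μ.real A) ^ n| ≤
      n * (∑ j ∈ Finset.Ico 1 l, μ.real (A ∩ (T^[j]) ⁻¹' A) + l * μ.real A ^ 2) := by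
  induction n with
  | zero => simp [GG]
  | succ n ih =>
    have h := rec_step hT hA l hl hind n
    set E := ∑ j ∈ Finset.Ico 1 l, μ.real (A ∩ (T^[j]) ⁻¹' A) + l * μ.real A ^ 2
    have ha0 : 0 ≤ μ.real A := measureReal_nonneg
    have ha1 : μ.real A ≤ 1 := measureReal_le_one
    have : μ.real (GG T A (n+1)) - (1 - μ.real A) ^ (n+1) =
      (μ.real (GG T A (n+1)) - (1 - μ.real A) * μ.real (GG T A n)) +
      (1 - μ.real A) * (μ.real (GG T A n) - (1 - μ.real A) ^ n) := by ring
    rw [this]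
    refine (abs_add_le _ _).trans ?_
    rw [abs_mul, abs_of_nonneg (by linarith : 0 ≤ 1 - μ.real A)]
    have : (1 - μ.real A) * |μ.real (GG T A n) - (1 - μ.real A) ^ n| ≤ |μ.real (GG T A n) - (1 - μ.real A) ^ n| :=
      mul_le_of_le_one_left (abs_nonneg _) (by linarith)
    push_cast
    linarith

lemma GG_compare (hT : MeasurePreserving T μ μ) {A B : Set α} (hA : MeasurableSet A)
    (hB : MeasurableSet B) (hBA : B ⊆ A) (n : ℕ) :
    |μ.real (GG T B n) - μ.real (GG T A n)| ≤ n * μ.real (A \ B) := by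
  have h1 : μ.real (GG T A n) ≤ μ.real (GG T B n) := by
    apply measureReal_mono _ (by finiteness)
    intro p hp j hj hb
    exact hp j hj (hBA hb)
  have h2 : μ.real (GG T B n) ≤ μ.real (GG T A n) + n * μ.real (A \ B) := by
    have : GG T B n ⊆ GG T A n ∪ ⋃ j ∈ Finset.range n, (T^[j]) ⁻¹' (A \ B) := by
      intro p hp
      by_cases hc : p ∈ GG T A n
      · exact Or.inl hc
      right
      simp only [GG, Set.mem_ofPred_eq, not_forall, not_not] at hc
      obtain ⟨i, hi, hi2⟩ := hc
      simp only [Set.mem_iUnion]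
      exact ⟨i, by simpa using hi, hi2, hp i hi⟩
    refine (measureReal_mono this (by finiteness)).trans ((measureReal_union_le _ _).trans ?_)
    gcongr
    refine (measureReal_biUnion_finset_le _ _).trans ?_
    simp only [mp_real hT (hA.diff hB), Finset.sum_const, Finset.card_range, nsmul_eq_mul]
    rfl
  rw [abs_le]; constructor <;> linarith [show (0:ℝ) ≤ n * μ.real (A \ B) by positivity]
end abs

/-- Lebesgue on [0,1) -/
noncomputable def lam : Measure ℝ := volume.restrict (Set.Ico (0:ℝ) 1)
/-- Lebesgue on the half-open square -/
noncomputable def sqm : Measure (ℝ × ℝ) := lam.prod lam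
/-- half-open square -/
def hSq : Set (ℝ × ℝ) := Set.Ico (0:ℝ) 1 ×ˢ Set.Ico (0:ℝ) 1

instance : IsProbabilityMeasure lam := ⟨by simp [lam]⟩
instance : IsProbabilityMeasure sqm := by unfold sqm; infer_instance

lemma sqm_eq : sqm = volume.restrict hSq := by
  simp only [sqm, lam, hSq, Measure.prod_restrict, Measure.volume_eq_prod]

lemma sqm_eq' : volume.restrict unitSq = sqm := by
  simp only [sqm, lam, unitSq, Measure.volume_eq_prod]
  rw [← Measure.prod_restrict, Measure.restrict_congr_set (Ico_ae_eq_Icc (μ := volume) (a := (0:ℝ)) (b := 1))]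

lemma sqm_ae : ∀ᵐ p ∂sqm, p ∈ hSq := by
  rw [sqm_eq]
  exact ae_restrict_mem (measurableSet_Ico.prod measurableSet_Ico)

lemma aff_mp (c d : ℝ) : MeasurePreserving (fun p : ℝ × ℝ => (2⁻¹ * p.1 + c, 2 * p.2 + d)) volume volume := by
  have h1 : MeasurePreserving (Prod.map (fun x : ℝ => 2⁻¹ * x) (fun y : ℝ => 2 * y)) volume volume := by
    refine ⟨by fun_prop, ?_⟩
    rw [Measure.volume_eq_prod, ← Measure.map_prod_map _ _ (by fun_prop) (by fun_prop),
      Real.map_volume_mul_left (by norm_num), Real.map_volume_mul_left (by norm_num),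
      Measure.prod_smul_left, Measure.prod_smul_right, smul_smul, ← ENNReal.ofReal_mul (by positivity)]
    norm_num
  have h2 := (measurePreserving_add_right (volume : Measure (ℝ × ℝ)) (c, d)).comp h1
  exact h2

lemma baker_meas : Measurable bakerMap := by
  unfold bakerMap
  exact Measurable.ite (measurableSet_lt measurable_snd measurable_const) (by fun_prop) (by fun_prop)

lemma baker_mem {p : ℝ × ℝ} (hp : p ∈ hSq) : bakerMap p ∈ hSq := by
  obtain ⟨⟨h1, h2⟩, h3, h4⟩ := hp
  unfold bakerMap
  split_ifs with h <;> refine ⟨⟨?_, ?_⟩, ?_, ?_⟩ <;> simp only <;> linarith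

lemma baker_iter_mem {p : ℝ × ℝ} (hp : p ∈ hSq) (n : ℕ) : bakerMap^[n] p ∈ hSq := by
  induction n with
  | zero => exact hp
  | succ n ih => rw [Function.iterate_succ_apply']; exact baker_mem ih

lemma baker_mp : MeasurePreserving bakerMap sqm sqm := by
  refine ⟨baker_meas, ?_⟩
  ext E hE
  rw [Measure.map_apply baker_meas hE, sqm_eq, Measure.restrict_apply (baker_meas hE),
    Measure.restrict_apply hE]
  have hS : MeasurableSet hSq := measurableSet_Ico.prod measurableSet_Ico
  set H : Set (ℝ × ℝ) := {p | p.1 < 1/2} with hH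
  have hHm : MeasurableSet H := measurableSet_lt measurable_fst measurable_const
  have e : bakerMap ⁻¹' E ∩ hSq =
      (fun p : ℝ × ℝ => (2⁻¹ * p.1 + 0, 2 * p.2 + 0)) ⁻¹' ((E ∩ hSq) ∩ H) ∪
      (fun p : ℝ × ℝ => (2⁻¹ * p.1 + 1/2, 2 * p.2 + (-1))) ⁻¹' ((E ∩ hSq) \ H) := by
    ext ⟨x, y⟩
    by_cases h : y < 1/2
    · have a1 : bakerMap (x, y) = (2⁻¹ * x + 0, 2 * y + 0) := by
        simp only [bakerMap, h, if_true]; ext <;> simp only <;> ring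
      have : ¬ (0 ≤ 2 * y + (-1)) := by linarith
      simp only [Set.mem_inter_iff, Set.mem_preimage, Set.mem_union, Set.mem_sdiff, a1]
      simp only [hSq, hH, Set.mem_prod, Set.mem_Ico, Set.mem_ofPred_eq, this, false_and, and_false, or_false]
      constructor
      · rintro ⟨h1, ⟨h2, h3⟩, h4, h5⟩
        refine ⟨⟨h1, ⟨?_, ?_⟩, ?_, ?_⟩, ?_⟩ <;> linarith
      · rintro ⟨⟨h1, ⟨h2, h3⟩, h4, h5⟩, h6⟩
        refine ⟨h1, ⟨?_, ?_⟩, ?_, ?_⟩ <;> linarith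
    · have a1 : bakerMap (x, y) = (2⁻¹ * x + 1/2, 2 * y + (-1)) := by
        simp only [bakerMap, h, if_false]; ext <;> simp only <;> ring
      have : ¬ (2 * y + 0 < 1) := by linarith
      simp only [Set.mem_inter_iff, Set.mem_preimage, Set.mem_union, Set.mem_sdiff, a1]
      simp only [hSq, hH, Set.mem_prod, Set.mem_Ico, Set.mem_ofPred_eq, this, false_and, and_false, false_or]
      constructor
      · rintro ⟨h1, ⟨h2, h3⟩, h4, h5⟩
        refine ⟨⟨h1, ⟨?_, ?_⟩, ?_, ?_⟩, ?_⟩ <;> linarith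
      · rintro ⟨⟨h1, ⟨h2, h3⟩, h4, h5⟩, h6⟩
        refine ⟨h1, ⟨?_, ?_⟩, ?_, ?_⟩ <;> linarith
  rw [e, measure_union]
  · rw [(aff_mp _ _).measure_preimage ((hE.inter hS).inter hHm).nullMeasurableSet,
      (aff_mp _ _).measure_preimage ((hE.inter hS).diff hHm).nullMeasurableSet,
      measure_inter_add_diff _ hHm]
  · rw [Set.disjoint_left]
    rintro ⟨x, y⟩ ⟨⟨-, h1⟩, -⟩ ⟨⟨-, h2⟩, -⟩
    have a := h1.2.2
    have b := h2.2.1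
    simp only at a b
    linarith
  · exact (aff_mp _ _).measurable ((hE.inter hS).diff hHm)

lemma iter_form (k : ℕ) (y : ℝ) : ∃ c e : ℤ, ∀ x : ℝ,
    bakerMap^[k] (x, y) = ((x + c) / 2 ^ k, 2 ^ k * y - e) := by
  induction k with
  | zero => exact ⟨0, 0, fun x => by simp⟩
  | succ k ih =>
    obtain ⟨c, e, h⟩ := ih
    by_cases hy : (2:ℝ) ^ k * y - e < 1/2
    · refine ⟨c, 2 * e, fun x => ?_⟩
      rw [Function.iterate_succ_apply', h]
      simp only [bakerMap, hy, if_true]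
      ext
      · simp only; rw [pow_succ]; field_simp
      · simp only; push_cast; ring
    · refine ⟨c + 2 ^ k, 2 * e + 1, fun x => ?_⟩
      rw [Function.iterate_succ_apply', h]
      simp only [bakerMap, hy, if_false]
      ext
      · simp only; push_cast; field_simp; ring
      · simp only; push_cast; ring

lemma swap_baker {p : ℝ × ℝ} (hp : p ∈ hSq) : bakerMap (bakerMap p).swap = p.swap := by
  obtain ⟨⟨h1, h2⟩, h3, h4⟩ := hp
  by_cases h : p.2 < 1/2
  · have : p.1 / 2 < 1/2 := by linarith
    simp only [bakerMap, h, if_true, Prod.swap, this]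
    ext <;> simp only <;> ring
  · have : ¬ ((p.1 + 1) / 2 < 1/2) := by linarith
    simp only [bakerMap, h, if_false, Prod.swap, this]
    ext <;> simp only <;> ring

lemma swap_iter {p : ℝ × ℝ} (hp : p ∈ hSq) (k : ℕ) :
    bakerMap^[k] (bakerMap^[k] p).swap = p.swap := by
  induction k with
  | zero => rfl
  | succ k ih =>
    rw [Function.iterate_succ_apply' (n := k) (x := p), Function.iterate_succ_apply,
      swap_baker (baker_iter_mem hp k), ih]

/-- dyadic cell -/
noncomputable def cell (k : ℕ) (p : ℝ × ℝ) : ℤ × ℤ := (⌊2 ^ k * p.1⌋, ⌊2 ^ k * p.2⌋)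

lemma cell_meas (k : ℕ) : Measurable (cell k) := by
  unfold cell
  exact Measurable.prodMk (Int.measurable_floor.comp (by fun_prop)) (Int.measurable_floor.comp (by fun_prop))

lemma cell_iter (k : ℕ) {x : ℝ} (hx : x ∈ Set.Ico (0:ℝ) 1) (y : ℝ) :
    cell k (bakerMap^[k] (x, y)) = cell k (bakerMap^[k] (0, y)) := by
  obtain ⟨c, e, h⟩ := iter_form k y
  rw [h, h]
  simp only [cell]
  ext
  · have : ∀ x : ℝ, (2:ℝ) ^ k * ((x + c) / 2 ^ k) = x + c := fun x => by field_simp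
    simp only [this, Int.floor_add_intCast]
    simp [Int.floor_eq_zero_iff.2 hx]
  · rfl

lemma cell_swap (k : ℕ) (p : ℝ × ℝ) : cell k p.swap = (cell k p).swap := rfl

lemma indep (k : ℕ) (I : Set (ℤ × ℤ)) (t : ℕ) :
    sqm.real (cell k ⁻¹' I ∩ (bakerMap^[2 * k]) ⁻¹' (GG bakerMap (cell k ⁻¹' I) t)) =
      sqm.real (cell k ⁻¹' I) * sqm.real (GG bakerMap (cell k ⁻¹' I) t) := by
  set A := cell k ⁻¹' I with hA
  have hAm : MeasurableSet A := cell_meas k (MeasurableSet.of_discrete)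
  have itm : ∀ j, Measurable (bakerMap^[j]) := fun j => (baker_mp.iterate j).measurable
  set E : Set ℝ := {s | (bakerMap^[k] (0, s)).swap ∈ A} with hE
  set F : Set ℝ := {s | bakerMap^[k] (0, s) ∈ GG bakerMap A t} with hF
  have hEm : MeasurableSet E := ((measurable_swap.comp (itm k)).comp (by fun_prop : Measurable fun s : ℝ => ((0:ℝ), s))) hAm
  have hFm : MeasurableSet F := ((itm k).comp (by fun_prop : Measurable fun s : ℝ => ((0:ℝ), s))) (GG_meas baker_mp hAm t)
  have f1 : ∀ p ∈ hSq, (p ∈ A ↔ (bakerMap^[k] p).1 ∈ E) := by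
    intro p hp
    have h1 := swap_iter hp k
    have h2 := baker_iter_mem hp k
    set w := bakerMap^[k] p
    have h3 := cell_iter k (x := w.2) h2.2 w.1
    have : w.swap = (w.2, w.1) := rfl
    rw [this] at h1
    rw [h1] at h3
    have h4 : cell k p = cell k (bakerMap^[k] (0, w.1)).swap := by
      rw [cell_swap, ← h3, cell_swap, Prod.swap_swap]
    simp only [hA, hE, Set.mem_preimage, Set.mem_ofPred_eq, h4]
  have f2 : ∀ p ∈ hSq, (bakerMap^[k] p ∈ GG bakerMap A t ↔ p.2 ∈ F) := by
    intro p hp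
    simp only [hF, GG, Set.mem_ofPred_eq]
    refine forall₂_congr fun j hj => ?_
    rw [not_iff_not]
    simp only [hA, Set.mem_preimage]
    simp only [← Function.iterate_add_apply]
    rw [add_comm, Function.iterate_add_apply, Function.iterate_add_apply]
    have m1 := baker_iter_mem hp j
    have m2 : bakerMap^[j] (0, p.2) ∈ hSq := by
      refine baker_iter_mem (p := (0, p.2)) ⟨?_, hp.2⟩ j
      simp
    have e : (bakerMap^[j] p).2 = (bakerMap^[j] (0, p.2)).2 := by
      obtain ⟨c, e, h⟩ := iter_form j p.2
      rw [h, ← Prod.mk.eta (p := p), h]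
    have c1 := cell_iter k m1.1 (bakerMap^[j] p).2
    have c2 := cell_iter k m2.1 (bakerMap^[j] (0, p.2)).2
    rw [Prod.mk.eta] at c1 c2
    rw [c1, c2, e]
  have hGm := GG_meas baker_mp hAm t
  have e1 : sqm.real A = lam.real E := by
    have : sqm.real A = sqm.real ((bakerMap^[k]) ⁻¹' (E ×ˢ Set.univ)) := by
      apply measureReal_congr
      rw [Filter.eventuallyEq_set]
      filter_upwards [sqm_ae] with p hp
      have := f1 p hp
      simp [this]
    rw [this, mp_real baker_mp (hEm.prod MeasurableSet.univ)]
    simp [sqm, Measure.real]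
  have e2 : sqm.real (GG bakerMap A t) = lam.real F := by
    rw [← mp_real baker_mp hGm k]
    have : sqm.real ((bakerMap^[k]) ⁻¹' (GG bakerMap A t)) = sqm.real (Set.univ ×ˢ F) := by
      apply measureReal_congr
      rw [Filter.eventuallyEq_set]
      filter_upwards [sqm_ae] with p hp
      have := f2 p hp
      simp [this]
    rw [this]
    simp [sqm, Measure.real]
  have e3 : sqm.real (A ∩ (bakerMap^[2 * k]) ⁻¹' (GG bakerMap A t)) = lam.real E * lam.real F := by
    have : sqm.real (A ∩ (bakerMap^[2 * k]) ⁻¹' (GG bakerMap A t)) = sqm.real ((bakerMap^[k]) ⁻¹' (E ×ˢ F)) := by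
      apply measureReal_congr
      rw [Filter.eventuallyEq_set]
      filter_upwards [sqm_ae] with p hp
      have h1 := f1 p hp
      have h2 := f2 _ (baker_iter_mem hp k)
      simp only [Set.mem_inter_iff, Set.mem_preimage, Set.mem_prod, h1, two_mul,
        Function.iterate_add_apply, h2]
    rw [this, mp_real baker_mp (hEm.prod hFm)]
    simp [sqm, Measure.real]
  rw [e1, e2, e3]

lemma lam_Ioo_le {a b : ℝ} (h : a ≤ b) : lam.real (Set.Ioo a b) ≤ b - a := by
  have : lam (Set.Ioo a b) ≤ ENNReal.ofReal (b - a) := by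
    rw [← Real.volume_Ioo]; exact Measure.restrict_apply_le _ _
  exact ENNReal.toReal_le_of_le_ofReal (by linarith) this

/-- vertical return set -/
def YY (c R : ℝ) (j : ℕ) : Set ℝ := {y | |y - c| < R ∧ ∃ e : ℤ, |2 ^ j * y - e - c| < R}

lemma YY_key {c R y : ℝ} {j : ℕ} {e : ℤ} (h1 : |y - c| < R) (h2 : |2 ^ j * y - e - c| < R) :
    |(2 ^ j - 1) * c - e| < R * (1 + 2 ^ j) := by
  have : (2 ^ j - 1) * c - e = (2 ^ j * y - e - c) - 2 ^ j * (y - c) := by ring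
  rw [this]
  refine (abs_sub _ _).trans_lt ?_
  rw [abs_mul, abs_of_pos (by positivity : (0:ℝ) < 2 ^ j)]
  have := mul_lt_mul_of_pos_left h1 (by positivity : (0:ℝ) < 2 ^ j)
  linarith

lemma YY_le {c R : ℝ} (hR : 0 ≤ R) (j : ℕ) : lam.real (YY c R j) ≤ 2 * R * (4 * R + (1/2) ^ j) := by
  set C := (2 ^ j - 1) * c with hC
  set w := R * (1 + 2 ^ j) with hw
  have hw0 : 0 ≤ w := by positivity
  have hp : (0:ℝ) < 2 ^ j := by positivity
  have hp1 : (1:ℝ) ≤ 2 ^ j := one_le_pow₀ (by norm_num)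
  have hsub : YY c R j ⊆ ⋃ e ∈ Finset.Icc ⌈C - w⌉ ⌊C + w⌋,
      Set.Ioo ((e + c - R) / 2 ^ j) ((e + c + R) / 2 ^ j) := by
    rintro y ⟨h1, e, h2⟩
    have h3 := YY_key h1 h2
    rw [abs_lt] at h2 h3
    simp only [Set.mem_iUnion]
    refine ⟨e, ?_, ?_, ?_⟩
    · rw [Finset.mem_Icc, Int.ceil_le, Int.le_floor]
      constructor <;> linarith
    · rw [div_lt_iff₀ hp]; linarith
    · rw [lt_div_iff₀ hp]; linarith
  refine (measureReal_mono hsub (measure_ne_top _ _)).trans ((measureReal_biUnion_finset_le _ _).trans ?_)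
  have hb : ∀ e ∈ Finset.Icc ⌈C - w⌉ ⌊C + w⌋,
      lam.real (Set.Ioo (((e:ℝ) + c - R) / 2 ^ j) ((e + c + R) / 2 ^ j)) ≤ 2 * R / 2 ^ j := by
    intro e _
    refine (lam_Ioo_le ?_).trans (le_of_eq ?_)
    · gcongr; linarith
    · ring
  refine (Finset.sum_le_card_nsmul _ _ _ hb).trans ?_
  rw [nsmul_eq_mul, Int.card_Icc]
  have hc : (((⌊C + w⌋ + 1 - ⌈C - w⌉).toNat : ℕ) : ℝ) ≤ 2 * w + 1 := by
    rw [← Int.cast_natCast, Int.toNat_eq_max]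
    push_cast
    apply max_le
    · have := Int.floor_le (C + w)
      have := Int.le_ceil (C - w)
      linarith
    · linarith
  calc _ ≤ (2 * w + 1) * (2 * R / 2 ^ j) := by gcongr
    _ ≤ (2 * (R * (2 ^ j + 2 ^ j)) + 1) * (2 * R / 2 ^ j) := by rw [hw]; gcongr
    _ = 2 * R * (4 * R + (1/2) ^ j) := by
      rw [one_div, inv_pow]; field_simp; ring

lemma YY_empty {c R : ℝ} {j : ℕ} (h : ∀ e : ℤ, R * (1 + 2 ^ j) ≤ |(2 ^ j - 1) * c - e|) :
    YY c R j = ∅ := by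
  rw [Set.eq_empty_iff_forall_notMem]
  rintro y ⟨h1, e, h2⟩
  exact absurd (YY_key h1 h2) (not_lt.2 (h e))

lemma ball_abs {z p : ℝ × ℝ} {R : ℝ} (h : p ∈ euclBall z R) : |p.1 - z.1| < R ∧ |p.2 - z.2| < R :=
  ⟨(Real.abs_le_sqrt (by nlinarith [sq_nonneg (p.2 - z.2)])).trans_lt h,
   (Real.abs_le_sqrt (by nlinarith [sq_nonneg (p.1 - z.1)])).trans_lt h⟩

lemma ret_le {z : ℝ × ℝ} {R : ℝ} (hR : 0 ≤ R) {A : Set (ℝ × ℝ)} (hA : A ⊆ euclBall z R) (j : ℕ) :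
    sqm.real (A ∩ (bakerMap^[j]) ⁻¹' A) ≤ 2 * R * lam.real (YY z.2 R j) := by
  have hsub : A ∩ (bakerMap^[j]) ⁻¹' A ⊆ Set.Ioo (z.1 - R) (z.1 + R) ×ˢ YY z.2 R j := by
    rintro ⟨x, y⟩ ⟨h1, h2⟩
    have a1 := ball_abs (hA h1)
    have a2 := (ball_abs (hA h2)).2
    obtain ⟨c, e, h⟩ := iter_form j y
    rw [h] at a2
    have := abs_lt.1 a1.1
    refine ⟨⟨?_, ?_⟩, a1.2, e, a2⟩ <;> simp only at * <;> linarith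
  refine (measureReal_mono hsub (by finiteness)).trans ?_
  have : sqm.real (Set.Ioo (z.1 - R) (z.1 + R) ×ˢ YY z.2 R j) =
      lam.real (Set.Ioo (z.1 - R) (z.1 + R)) * lam.real (YY z.2 R j) := by
    simp [sqm, Measure.real]
  rw [this]
  gcongr
  refine (lam_Ioo_le (by linarith)).trans (le_of_eq (by ring))

lemma euclBall_eq (z : ℝ × ℝ) (r : ℝ) :
    euclBall z r = Complex.measurableEquivRealProd.symm ⁻¹' Metric.ball (⟨z.1, z.2⟩ : ℂ) r := by
  ext p
  simp [euclBall, Complex.dist_eq_re_im, Metric.mem_ball, Complex.measurableEquivRealProd]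

lemma euclBall_meas (z : ℝ × ℝ) (r : ℝ) : MeasurableSet (euclBall z r) := by
  rw [euclBall_eq]
  exact Complex.measurableEquivRealProd.symm.measurable Metric.isOpen_ball.measurableSet

lemma euclBall_vol (z : ℝ × ℝ) {r : ℝ} (hr : 0 ≤ r) :
    volume (euclBall z r) = ENNReal.ofReal (Real.pi * r ^ 2) := by
  rw [euclBall_eq, Complex.volume_preserving_equiv_real_prod.symm.measure_preimage
    Metric.isOpen_ball.measurableSet.nullMeasurableSet, Complex.volume_ball,
    ENNReal.ofReal_mul Real.pi_nonneg, ENNReal.ofReal_pow hr, mul_comm]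
  congr 1
  rw [← NNReal.coe_real_pi, ENNReal.ofReal_coe_nnreal]

lemma euclBall_le (z : ℝ × ℝ) {r : ℝ} (hr : 0 ≤ r) : sqm.real (euclBall z r) ≤ Real.pi * r ^ 2 := by
  apply ENNReal.toReal_le_of_le_ofReal (by positivity)
  rw [← euclBall_vol z hr, sqm_eq]
  exact Measure.restrict_apply_le _ _

lemma euclBall_real_eq {z : ℝ × ℝ} {r : ℝ} (hr : 0 ≤ r) (h : euclBall z r ⊆ hSq) :
    sqm.real (euclBall z r) = Real.pi * r ^ 2 := by
  rw [Measure.real, sqm_eq, Measure.restrict_apply (euclBall_meas z r),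
    Set.inter_eq_left.2 h, euclBall_vol z hr, ENNReal.toReal_ofReal (by positivity)]

lemma euclDist_tri (p q z : ℝ × ℝ) : euclDist p z ≤ |p.1 - q.1| + |p.2 - q.2| + euclDist q z := by
  have h1 := dist_triangle (⟨p.1, p.2⟩ : ℂ) ⟨q.1, q.2⟩ ⟨z.1, z.2⟩
  have h2 : dist (⟨p.1, p.2⟩ : ℂ) ⟨q.1, q.2⟩ ≤ |p.1 - q.1| + |p.2 - q.2| := by
    rw [dist_eq_norm]
    exact Complex.norm_le_abs_re_add_abs_im _
  rw [Complex.dist_eq_re_im] at h1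
  rw [Complex.dist_eq_re_im ⟨q.1, q.2⟩] at h1
  unfold euclDist
  simp only at h1
  linarith

lemma cell_near {k : ℕ} {p q : ℝ × ℝ} (h : cell k p = cell k q) :
    |p.1 - q.1| ≤ (1/2) ^ k ∧ |p.2 - q.2| ≤ (1/2) ^ k := by
  have key : ∀ a b : ℝ, ⌊2 ^ k * a⌋ = ⌊2 ^ k * b⌋ → |a - b| ≤ (1/2) ^ k := by
    intro a b hab
    have := Int.abs_sub_lt_one_of_floor_eq_floor hab
    rw [← mul_sub, abs_mul, abs_of_pos (by positivity : (0:ℝ) < 2 ^ k)] at this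
    rw [one_div, inv_pow, ← one_div, le_div_iff₀ (by positivity)]
    linarith
  simp only [cell, Prod.mk.injEq] at h
  exact ⟨key _ _ h.1, key _ _ h.2⟩

/-- cell saturation of a ball -/
noncomputable def AA (z : ℝ × ℝ) (r : ℝ) (k : ℕ) : Set (ℝ × ℝ) := cell k ⁻¹' (cell k '' euclBall z r)

lemma AA_meas (z : ℝ × ℝ) (r : ℝ) (k : ℕ) : MeasurableSet (AA z r k) :=
  cell_meas k MeasurableSet.of_discrete

lemma ball_sub_AA (z : ℝ × ℝ) (r : ℝ) (k : ℕ) : euclBall z r ⊆ AA z r k :=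
  Set.subset_preimage_image _ _

lemma AA_sub (z : ℝ × ℝ) (r : ℝ) (k : ℕ) : AA z r k ⊆ euclBall z (r + 2 * (1/2) ^ k) := by
  rintro p ⟨q, hq, hqp⟩
  have h1 := cell_near hqp.symm
  have h2 := euclDist_tri p q z
  have h3 : euclDist q z < r := hq
  change euclDist p z < _
  linarith [h1.1, h1.2]

/-- the exceedance set -/
noncomputable def BB (z : ℝ × ℝ) (u : ℝ) : Set (ℝ × ℝ) := {w | ¬ (-Real.log (euclDist w z) ≤ u)}

lemma BB_meas (z : ℝ × ℝ) (u : ℝ) : MeasurableSet (BB z u) := by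
  have h : Measurable fun w : ℝ × ℝ => -Real.log (euclDist w z) := by
    unfold euclDist
    fun_prop
  exact (measurableSet_le h measurable_const).compl

lemma BB_sub (z : ℝ × ℝ) (u : ℝ) : BB z u ⊆ euclBall z (Real.exp (-u)) := by
  intro w hw
  by_contra hc
  apply hw
  have hd : Real.exp (-u) ≤ euclDist w z := not_lt.1 hc
  have := Real.log_le_log (Real.exp_pos _) hd
  rw [Real.log_exp] at this
  linarith

lemma sub_BB (z : ℝ × ℝ) (u : ℝ) : euclBall z (Real.exp (-u)) ⊆ BB z u ∪ {z} := by
  intro w hw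
  have hd : euclDist w z < Real.exp (-u) := hw
  rcases (Real.sqrt_nonneg ((w.1 - z.1) ^ 2 + (w.2 - z.2) ^ 2)).eq_or_lt with h | h
  · right
    have h' := (Real.sqrt_eq_zero (by positivity)).1 h.symm
    have h1 : w.1 - z.1 = 0 := by nlinarith [sq_nonneg (w.1 - z.1), sq_nonneg (w.2 - z.2)]
    have h2 : w.2 - z.2 = 0 := by nlinarith [sq_nonneg (w.1 - z.1), sq_nonneg (w.2 - z.2)]
    exact Prod.ext (by linarith) (by linarith)
  · left
    have := Real.log_lt_log h hd
    rw [Real.log_exp] at this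
    change ¬ (-Real.log (euclDist w z) ≤ u)
    unfold euclDist
    linarith

lemma BB_real (z : ℝ × ℝ) (u : ℝ) : sqm.real (BB z u) = sqm.real (euclBall z (Real.exp (-u))) := by
  apply le_antisymm (measureReal_mono (BB_sub z u) (by finiteness))
  refine (measureReal_mono (sub_BB z u) (by finiteness)).trans ((measureReal_union_le _ _).trans ?_)
  have : sqm {z} = 0 := by
    rw [sqm_eq]
    refine le_antisymm ((Measure.restrict_apply_le _ _).trans ?_) zero_le
    simp
  simp [Measure.real, this]

lemma ae_good : ∀ᵐ z ∂sqm, z ∈ hSq ∧ Irrational z.1 ∧ Irrational z.2 := by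
  have h : ∀ᵐ y ∂lam, Irrational y := by
    apply ae_restrict_of_ae
    exact (Set.countable_range (Rat.cast : ℚ → ℝ)).ae_notMem volume
  have h1 : ∀ᵐ z ∂sqm, Irrational z.1 := Measure.quasiMeasurePreserving_fst.ae h
  have h2 : ∀ᵐ z ∂sqm, Irrational z.2 := Measure.quasiMeasurePreserving_snd.ae h
  filter_upwards [sqm_ae, h1, h2] with z a b c using ⟨a, b, c⟩

lemma irr_ne {c : ℝ} (h : Irrational c) {j : ℕ} (hj : 1 ≤ j) (e : ℤ) : (2 ^ j - 1) * c - e ≠ 0 := by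
  intro h0
  have h1 : (1:ℝ) < 2 ^ j := one_lt_pow₀ (by norm_num) (by omega)
  apply h
  refine ⟨e / (2 ^ j - 1), ?_⟩
  push_cast
  rw [div_eq_iff (by linarith)]
  linarith

lemma nonper {z : ℝ × ℝ} (h : Irrational z.2) (n : ℕ) (hn : 1 ≤ n) : bakerMap^[n] z ≠ z := by
  intro hz
  obtain ⟨c, e, hf⟩ := iter_form n z.2
  have := hf z.1
  rw [Prod.mk.eta, hz] at this
  have := congrArg Prod.snd this
  simp only at this
  exact irr_ne h hn e (by linarith)

lemma tend_of_sq {f : ℕ → ℝ} (h0 : ∀ n, 0 ≤ f n) (h : Tendsto (fun n => f n ^ 2) atTop (𝓝 0)) :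
    Tendsto f atTop (𝓝 0) := by
  have := h.sqrt
  simpa [Real.sqrt_sq (h0 _)] using this

lemma log_tend : Tendsto (fun n : ℕ => ((Nat.log 2 n : ℕ) : ℝ) ^ 2 * (n : ℝ)⁻¹) atTop (𝓝 0) := by
  have h1 : Tendsto (fun x : ℝ => Real.log x ^ 2 / x) atTop (𝓝 0) := by
    have := Real.tendsto_pow_log_div_mul_add_atTop 1 0 2 (by norm_num)
    simpa using this
  have h2 : Tendsto (fun n : ℕ => (Real.log 2)⁻¹ ^ 2 * (Real.log n ^ 2 / n)) atTop (𝓝 0) := by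
    have := (h1.comp tendsto_natCast_atTop_atTop).const_mul ((Real.log 2)⁻¹ ^ 2)
    rw [mul_zero] at this
    exact this
  refine squeeze_zero' (Eventually.of_forall fun n => by positivity) ?_ h2
  filter_upwards [eventually_ge_atTop 1] with n hn
  have hl : 0 < Real.log 2 := Real.log_pos (by norm_num)
  have h3 : ((Nat.log 2 n : ℕ) : ℝ) ≤ (Real.log 2)⁻¹ * Real.log n := by
    rw [inv_mul_eq_div, le_div_iff₀ hl, ← Real.log_pow]
    apply Real.log_le_log (by positivity)
    exact_mod_cast Nat.pow_log_le_self 2 (by omega)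
  calc _ ≤ ((Real.log 2)⁻¹ * Real.log n) ^ 2 * (n : ℝ)⁻¹ := by gcongr
    _ = _ := by rw [mul_pow, div_eq_mul_inv]; ring

lemma main_conv {z : ℝ × ℝ} (hz : z ∈ hSq) (hz1 : Irrational z.1) (hz2 : Irrational z.2)
    (τ : ℝ) (u : ℕ → ℝ)
    (hu : Tendsto (fun n : ℕ => (n : ℝ) * sqm.real (euclBall z (Real.exp (-u n)))) atTop (𝓝 τ)) :
    Tendsto (fun n : ℕ => sqm.real (GG bakerMap (BB z (u n)) n)) atTop (𝓝 (Real.exp (-τ))) := by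
  set r : ℕ → ℝ := fun n => Real.exp (-u n) with hr
  have hr0 : ∀ n, 0 < r n := fun n => Real.exp_pos _
  have hinv : Tendsto (fun n : ℕ => (n : ℝ)⁻¹) atTop (𝓝 0) := tendsto_inv_atTop_nhds_zero_nat
  -- ball inside the square
  obtain ⟨ε, hε, hball⟩ : ∃ ε > 0, ∀ s ≤ ε, euclBall z s ⊆ hSq := by
    have hx : 0 < z.1 := lt_of_le_of_ne hz.1.1 (fun h => hz1 ⟨0, by simp [h]⟩)
    have hy : 0 < z.2 := lt_of_le_of_ne hz.2.1 (fun h => hz2 ⟨0, by simp [h]⟩)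
    have hx1 : 0 < 1 - z.1 := by linarith [hz.1.2]
    have hy1 : 0 < 1 - z.2 := by linarith [hz.2.2]
    refine ⟨min (min z.1 z.2) (min (1 - z.1) (1 - z.2)), by positivity, fun s hs p hp => ?_⟩
    have := ball_abs hp
    rw [abs_lt, abs_lt] at this
    simp only [le_min_iff] at hs
    refine ⟨⟨?_, ?_⟩, ?_, ?_⟩ <;> linarith [this.1.1, this.1.2, this.2.1, this.2.2]
  have hμ0 : Tendsto (fun n : ℕ => sqm.real (euclBall z (r n))) atTop (𝓝 0) := by
    have := hinv.mul hu
    rw [zero_mul] at this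
    refine this.congr' ?_
    filter_upwards [eventually_ge_atTop 1] with n hn
    have : (n:ℝ) ≠ 0 := by positivity
    field_simp
    rfl
  have hin : ∀ᶠ n in atTop, euclBall z (r n) ⊆ hSq := by
    have hpos : 0 < Real.pi * ε ^ 2 := by positivity
    filter_upwards [hμ0.eventually (gt_mem_nhds hpos)] with n hn
    apply hball
    by_contra hc
    push Not at hc
    have : sqm.real (euclBall z ε) ≤ sqm.real (euclBall z (r n)) := by
      apply measureReal_mono _ (measure_ne_top _ _)
      intro p hp
      exact lt_trans hp hc
    rw [euclBall_real_eq hε.le (hball ε le_rfl)] at this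
    linarith
  have F1 : Tendsto (fun n : ℕ => (n : ℝ) * (Real.pi * r n ^ 2)) atTop (𝓝 τ) := by
    refine hu.congr' ?_
    filter_upwards [hin] with n hn
    rw [← euclBall_real_eq (hr0 n).le hn]
  have F2 : Tendsto r atTop (𝓝 0) := by
    apply tend_of_sq (fun n => (hr0 n).le)
    have := (hμ0.const_mul (Real.pi)⁻¹)
    rw [mul_zero] at this
    refine this.congr' ?_
    filter_upwards [hin] with n hn
    rw [euclBall_real_eq (hr0 n).le hn]
    field_simp
  set k : ℕ → ℕ := fun n => Nat.log 2 n with hk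
  set δ : ℕ → ℝ := fun n => 2 * (1/2) ^ k n with hδ
  have hδ0 : ∀ n, 0 < δ n := fun n => by simp only [hδ]; positivity
  have hnδ : ∀ n : ℕ, n * δ n ≤ 4 := by
    intro n
    have : (n:ℝ) ≤ 2 ^ (k n + 1) := by exact_mod_cast (Nat.lt_pow_succ_log_self (by norm_num) n).le
    simp only [hδ]
    calc (n:ℝ) * (2 * (1/2) ^ k n) ≤ 2 ^ (k n + 1) * (2 * (1/2) ^ k n) := by gcongr
      _ = 4 := by rw [pow_succ, one_div, inv_pow]; field_simp; norm_num
  have F3 : Tendsto δ atTop (𝓝 0) := by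
    have h4 : Tendsto (fun n : ℕ => 4 * (n : ℝ)⁻¹) atTop (𝓝 0) := by simpa using hinv.const_mul 4
    refine squeeze_zero' (Eventually.of_forall fun n => (hδ0 n).le) ?_ h4
    filter_upwards [eventually_ge_atTop 1] with n hn
    have : (0:ℝ) < n := by positivity
    rw [← div_eq_mul_inv, le_div_iff₀ this, mul_comm]
    exact hnδ n
  set R : ℕ → ℝ := fun n => r n + δ n with hR
  have hR0 : ∀ n, 0 < R n := fun n => add_pos (hr0 n) (hδ0 n)
  have FR : Tendsto R atTop (𝓝 0) := by simpa using F2.add F3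
  have F4 : Tendsto (fun n : ℕ => (n : ℝ) * (Real.pi * R n ^ 2)) atTop (𝓝 τ) := by
    have h1 : Tendsto (fun n : ℕ => Real.pi * (n * δ n * (2 * r n + δ n))) atTop (𝓝 0) := by
      have h2 : Tendsto (fun n : ℕ => Real.pi * (4 * (2 * r n + δ n))) atTop (𝓝 0) := by
        simpa using (((F2.const_mul 2).add F3).const_mul 4).const_mul Real.pi
      refine squeeze_zero (fun n => ?_) (fun n => ?_) h2
      · have := hr0 n; have := hδ0 n; positivity
      · have := hr0 n; have := hδ0 n; have := hnδ n; gcongr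
    have h3 := F1.add h1
    rw [add_zero] at h3
    refine h3.congr fun n => ?_
    simp only [hR]; ring
  set A : ℕ → Set (ℝ × ℝ) := fun n => AA z (r n) (k n) with hA
  have hAm : ∀ n, MeasurableSet (A n) := fun n => AA_meas _ _ _
  have hAR : ∀ n, A n ⊆ euclBall z (R n) := fun n => AA_sub _ _ _
  have hale : ∀ n, sqm.real (A n) ≤ Real.pi * R n ^ 2 := fun n =>
    (measureReal_mono (hAR n) (measure_ne_top _ _)).trans (euclBall_le z (hR0 n).le)
  have hage : ∀ n, sqm.real (euclBall z (r n)) ≤ sqm.real (A n) := fun n =>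
    measureReal_mono (ball_sub_AA _ _ _) (measure_ne_top _ _)
  have F5 : Tendsto (fun n : ℕ => (n : ℝ) * sqm.real (A n)) atTop (𝓝 τ) := by
    refine tendsto_of_tendsto_of_tendsto_of_le_of_le hu F4 (fun n => ?_) (fun n => ?_)
    · exact mul_le_mul_of_nonneg_left (hage n) (by positivity)
    · exact mul_le_mul_of_nonneg_left (hale n) (by positivity)
  have F6 : Tendsto (fun n : ℕ => (n : ℝ) * sqm.real (A n \ BB z (u n))) atTop (𝓝 0) := by
    have := F5.sub hu
    rw [sub_self] at this
    refine this.congr fun n => ?_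
    have hsub : BB z (u n) ⊆ A n := (BB_sub z (u n)).trans (ball_sub_AA _ _ _)
    rw [measureReal_sdiff hsub (BB_meas z (u n)), BB_real]
    ring
  have F7 : Tendsto (fun n : ℕ => (1 - sqm.real (A n)) ^ n) atTop (𝓝 (Real.exp (-τ))) := by
    have := Real.tendsto_one_add_pow_exp_of_tendsto (g := fun n => - sqm.real (A n)) (t := -τ)
      (by simpa using F5.neg)
    simpa [sub_eq_add_neg] using this
  have FnR : Tendsto (fun n : ℕ => (n : ℝ) * R n ^ 2) atTop (𝓝 (τ / Real.pi)) := by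
    refine (F4.div_const Real.pi).congr fun n => ?_
    field_simp
  have FkR : Tendsto (fun n : ℕ => (k n : ℝ) * R n) atTop (𝓝 0) := by
    apply tend_of_sq (fun n => by have := hR0 n; positivity)
    have := log_tend.mul FnR
    rw [zero_mul] at this
    refine this.congr' ?_
    filter_upwards [eventually_ge_atTop 1] with n hn
    have : (n:ℝ) ≠ 0 := by positivity
    simp only [hk]
    field_simp
  have F8a : Tendsto (fun n : ℕ => (n : ℝ) * (((2 * k n : ℕ) : ℝ) * sqm.real (A n) ^ 2)) atTop (𝓝 0) := by
    have h1 : Tendsto (fun n : ℕ => (n * sqm.real (A n)) * (2 * Real.pi * (k n * R n * R n))) atTop (𝓝 0) := by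
      simpa using F5.mul ((FkR.mul FR).const_mul (2 * Real.pi))
    refine squeeze_zero (fun n => by positivity) (fun n => ?_) h1
    push_cast
    calc (n:ℝ) * (2 * k n * sqm.real (A n) ^ 2) = (n * sqm.real (A n)) * (2 * k n * sqm.real (A n)) := by ring
      _ ≤ (n * sqm.real (A n)) * (2 * k n * (Real.pi * R n ^ 2)) := by gcongr; exact hale n
      _ = _ := by ring
  have F8b : Tendsto (fun n : ℕ => (n : ℝ) *
      ∑ j ∈ Finset.Ico 1 (2 * k n), sqm.real (A n ∩ (bakerMap^[j]) ⁻¹' (A n))) atTop (𝓝 0) := by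
    have hτ : 0 ≤ τ / Real.pi := ge_of_tendsto' FnR fun n => by positivity
    rw [Metric.tendsto_atTop']
    intro η hη
    obtain ⟨J, hJ1, hJ⟩ : ∃ J : ℕ, 1 ≤ J ∧ τ / Real.pi * (4 * (2 * (1/2) ^ J)) < η := by
      have h1 : Tendsto (fun J : ℕ => τ / Real.pi * (4 * (2 * (1/2 : ℝ) ^ J))) atTop (𝓝 0) := by
        simpa using (((tendsto_pow_atTop_nhds_zero_of_lt_one (r := (1/2:ℝ)) (by norm_num) (by norm_num)).const_mul 2).const_mul 4).const_mul (τ / Real.pi)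
      exact ((eventually_ge_atTop 1).and (h1.eventually (gt_mem_nhds hη))).exists
    have hbd : Tendsto (fun n : ℕ => (n * R n ^ 2) * (4 * (8 * (k n * R n) + 2 * (1/2) ^ J))) atTop
        (𝓝 (τ / Real.pi * (4 * (2 * (1/2) ^ J)))) := by
      simpa using FnR.mul (((FkR.const_mul 8).add_const (2 * (1/2 : ℝ) ^ J)).const_mul 4)
    have hsmall : ∀ᶠ n in atTop, ∀ j ∈ Finset.Ico 1 J, YY z.2 (R n) j = ∅ := by
      rw [Finset.eventually_all]
      intro j hj
      have hj1 := (Finset.mem_Ico.1 hj).1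
      set c := (2 ^ j - 1) * z.2 with hc
      have hd : 0 < |c - round c| := abs_pos.2 (irr_ne hz2 hj1 _)
      have hlim : Tendsto (fun n => R n * (1 + 2 ^ j)) atTop (𝓝 0) := by
        simpa using FR.mul_const (1 + (2:ℝ) ^ j)
      filter_upwards [hlim.eventually (gt_mem_nhds hd)] with n hn
      apply YY_empty
      intro e
      exact hn.le.trans (round_le c e)
    have hev : ∀ᶠ n : ℕ in atTop, (n : ℝ) *
      ∑ j ∈ Finset.Ico 1 (2 * k n), sqm.real (A n ∩ (bakerMap^[j]) ⁻¹' (A n)) < η := by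
      filter_upwards [hsmall, hbd.eventually (gt_mem_nhds hJ)] with n h1 h2
      refine lt_of_le_of_lt ?_ h2
      have hRn := hR0 n
      have hs : ∑ j ∈ Finset.Ico 1 (2 * k n), sqm.real (A n ∩ (bakerMap^[j]) ⁻¹' (A n)) ≤
          ∑ j ∈ Finset.Ico J (2 * k n), (2 * R n) * (2 * R n * (4 * R n + (1/2) ^ j)) := by
        have hsub : Finset.Ico J (2 * k n) ⊆ Finset.Ico 1 (2 * k n) :=
          Finset.Ico_subset_Ico_left hJ1
        rw [← Finset.sum_subset hsub]
        · refine Finset.sum_le_sum fun j _ => (ret_le hRn.le (hAR n) j).trans ?_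
          exact mul_le_mul_of_nonneg_left (YY_le hRn.le j) (by positivity)
        · intro j hj hj'
          rw [Finset.mem_Ico] at hj hj'
          have := ret_le hRn.le (hAR n) j
          rw [h1 j (by rw [Finset.mem_Ico]; omega)] at this
          simp only [measureReal_empty, mul_zero] at this
          exact le_antisymm this measureReal_nonneg
      have hs2 : ∑ j ∈ Finset.Ico J (2 * k n), (2 * R n) * (2 * R n * (4 * R n + (1/2) ^ j)) ≤
          4 * R n ^ 2 * (8 * (k n * R n) + 2 * (1/2) ^ J) := by
        have e1 : ∑ j ∈ Finset.Ico J (2 * k n), (2 * R n) * (2 * R n * (4 * R n + (1/2) ^ j)) =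
            4 * R n ^ 2 * (∑ j ∈ Finset.Ico J (2 * k n), 4 * R n + ∑ j ∈ Finset.Ico J (2 * k n), (1/2) ^ j) := by
          rw [← Finset.sum_add_distrib, Finset.mul_sum]
          refine Finset.sum_congr rfl fun j _ => by ring
        rw [e1]
        gcongr 4 * R n ^ 2 * (?_ + ?_)
        · rw [Finset.sum_const, Nat.card_Ico, nsmul_eq_mul]
          have : ((2 * k n - J : ℕ) : ℝ) ≤ 2 * k n := by
            have : 2 * k n - J ≤ 2 * k n := Nat.sub_le _ _
            exact_mod_cast this
          nlinarith
        · refine (geom_sum_Ico_le_of_lt_one (by norm_num) (by norm_num)).trans (le_of_eq ?_)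
          norm_num
          ring
      calc _ ≤ (n:ℝ) * (4 * R n ^ 2 * (8 * (k n * R n) + 2 * (1/2) ^ J)) :=
            mul_le_mul_of_nonneg_left (hs.trans hs2) (by positivity)
        _ = _ := by ring
    obtain ⟨N, hN⟩ := eventually_atTop.1 hev
    refine ⟨N, fun n hn => ?_⟩
    rw [Real.dist_eq, sub_zero, abs_of_nonneg]
    · exact hN n hn.le
    · exact mul_nonneg (by positivity) (Finset.sum_nonneg fun _ _ => measureReal_nonneg)
  -- conclusion
  have G1 : Tendsto (fun n : ℕ => sqm.real (GG bakerMap (A n) n) - (1 - sqm.real (A n)) ^ n) atTop (𝓝 0) := by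
    have h := F8b.add F8a
    rw [add_zero] at h
    refine squeeze_zero_norm' ?_ h
    filter_upwards [eventually_ge_atTop 2] with n hn
    have hk1 : 1 ≤ k n := Nat.log_pos (by norm_num) hn
    have := rec_all baker_mp (hAm n) (2 * k n) (by omega) (fun t => indep (k n) _ t) n
    rw [Real.norm_eq_abs, ← mul_add]
    exact this
  have G2 : Tendsto (fun n : ℕ => sqm.real (GG bakerMap (BB z (u n)) n) - sqm.real (GG bakerMap (A n) n)) atTop (𝓝 0) := by
    refine squeeze_zero_norm (fun n => ?_) F6
    exact GG_compare baker_mp (hAm n) (BB_meas z (u n)) ((BB_sub z (u n)).trans (ball_sub_AA _ _ _)) n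
  have := (G2.add G1).add F7
  simpa using this

/-- Gumbel law with extremal index `1` at non-periodic centers for the
standard baker's map: for Lebesgue-a.e. `z ∈ [0,1]²` (in particular `z` is
not periodic), for every `τ > 0` and boundary levels `u_n` with
`n · Leb(B(z, e^{-u_n})) → τ`, the Lebesgue measure of
`{x ∈ [0,1]² : max_{0 ≤ j < n} (-log d(T^j x, z)) ≤ u_n}` tends to `e^{-τ}`
(`d` the Euclidean distance, `B` the Euclidean ball). -/
theorem stmt_13 :
    ∀ᵐ z ∂(volume.restrict unitSq),
      (∀ n : ℕ, 1 ≤ n → bakerMap^[n] z ≠ z) ∧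
      ∀ τ : ℝ, 0 < τ → ∀ u : ℕ → ℝ,
        Tendsto (fun n : ℕ =>
            (n : ℝ) * ((volume.restrict unitSq) (euclBall z (Real.exp (-u n)))).toReal)
          atTop (𝓝 τ) →
        Tendsto (fun n : ℕ =>
            (volume.restrict unitSq)
              {x : ℝ × ℝ | ∀ j < n, -Real.log (euclDist (bakerMap^[j] x) z) ≤ u n})
          atTop (𝓝 (ENNReal.ofReal (Real.exp (-τ)))) := by
  rw [sqm_eq']
  filter_upwards [ae_good] with z hz
  obtain ⟨h0, h1, h2⟩ := hz
  refine ⟨nonper h2, fun τ _ u hu => ?_⟩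
  have h := main_conv h0 h1 h2 τ u hu
  refine (ENNReal.tendsto_ofReal h).congr fun n => ?_
  rw [Measure.real, ENNReal.ofReal_toReal (measure_ne_top _ _)]
  congr 1
  ext p
  simp [GG, BB]
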